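/- (Strong duality for the epigraph constraint.) Let T ≥ 2 and β_2, …, β_T ∈ ℝ. The infimum of (T·m̄ + γ₂·σ·√T)·s₁ + (γ₂·σ·√T − T·m̄)·s₂ over all s₁, s₂ ≥ 0 with s₁ − s₂ ≥ β_t for all 2 ≤ t ≤ T and s₁ − s₂ ≥ 0 is attained and equals L^CLT · max(0, max_{2≤t≤T} β_t); in particular, it coincides with the maximum of ∑_{t=2}^T β_t·l_{t−1} over l ∈ U^CLT. -/

import Mathlib

/-- The CLT uncertainty set: losses `l : {1,…,T} → ℝ` with `l t ≥ 0` and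
`|∑_{t=1}^T l t − T·m̄| ≤ γ₂·σ·√T`. -/
def UCLT (T : ℕ) (m σ γ₂ : ℝ) (l : ℕ → ℝ) : Prop :=
  (∀ t ∈ Finset.Icc 1 T, 0 ≤ l t) ∧
    |(∑ t ∈ Finset.Icc 1 T, l t) - (T : ℝ) * m| ≤ γ₂ * σ * Real.sqrt T

/-- `L^CLT = T·m̄ + γ₂·σ·√T`. -/
noncomputable def LCLT (T : ℕ) (m σ γ₂ : ℝ) : ℝ :=
  (T : ℝ) * m + γ₂ * σ * Real.sqrt T

theorem sum_Icc_one_eq_sum_pred_add {T : ℕ} (hT : 1 ≤ T) (l : ℕ → ℝ) :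
    ∑ t ∈ Finset.Icc 1 T, l t = ∑ t ∈ Finset.Icc 2 T, l (t - 1) + l T := by
  induction T, hT using Nat.le_induction with
  | base => simp
  | succ n hn ih =>
    rw [Finset.sum_Icc_succ_top (by omega), ih, Finset.sum_Icc_succ_top (by omega),
      Nat.add_sub_cancel]

theorem UCLT.sum_le {T : ℕ} {m σ γ₂ : ℝ} {l : ℕ → ℝ} (h : UCLT T m σ γ₂ l) :
    ∑ t ∈ Finset.Icc 1 T, l t ≤ LCLT T m σ γ₂ := by
  have := (abs_le.mp h.2).2
  unfold LCLT
  linarith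

theorem LCLT_nonneg (T : ℕ) {m σ γ₂ : ℝ} (hm : 0 ≤ m) (hσ : 0 ≤ σ) (hγ : 0 ≤ γ₂) :
    0 ≤ LCLT T m σ γ₂ := by
  unfold LCLT
  positivity

theorem UCLT_single {T k : ℕ} {m σ γ₂ : ℝ} (hm : 0 ≤ m) (hσ : 0 ≤ σ) (hγ : 0 ≤ γ₂)
    (hk : k ∈ Finset.Icc 1 T) : UCLT T m σ γ₂ (Pi.single k (LCLT T m σ γ₂)) := by
  have hnonneg : (0 : ℕ → ℝ) ≤ Pi.single k (LCLT T m σ γ₂) :=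
    Pi.single_nonneg.mpr (LCLT_nonneg T hm hσ hγ)
  refine ⟨fun t _ => hnonneg t, ?_⟩
  rw [Finset.sum_pi_single', if_pos hk, LCLT, add_sub_cancel_left, abs_of_nonneg (by positivity)]

/-- Any `M ≥ 0` dominating every `β t` bounds the primal objective by `L^CLT · M`. -/
theorem UCLT.sum_mul_le {T : ℕ} (hT : 1 ≤ T) {m σ γ₂ M : ℝ} {β l : ℕ → ℝ}
    (h : UCLT T m σ γ₂ l) (hM : 0 ≤ M) (hβ : ∀ t ∈ Finset.Icc 2 T, β t ≤ M) :
    ∑ t ∈ Finset.Icc 2 T, β t * l (t - 1) ≤ LCLT T m σ γ₂ * M := by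
  have hlT : 0 ≤ l T := h.1 T (Finset.mem_Icc.mpr ⟨hT, le_rfl⟩)
  calc ∑ t ∈ Finset.Icc 2 T, β t * l (t - 1)
      ≤ ∑ t ∈ Finset.Icc 2 T, M * l (t - 1) := by
        refine Finset.sum_le_sum fun t ht => mul_le_mul_of_nonneg_right (hβ t ht) (h.1 _ ?_)
        rw [Finset.mem_Icc] at ht ⊢
        omega
    _ = M * ∑ t ∈ Finset.Icc 2 T, l (t - 1) := (Finset.mul_sum ..).symm
    _ ≤ M * LCLT T m σ γ₂ := by
        refine mul_le_mul_of_nonneg_left ?_ hM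
        have := h.sum_le
        rw [sum_Icc_one_eq_sum_pred_add hT] at this
        linarith
    _ = LCLT T m σ γ₂ * M := mul_comm ..

theorem sum_mul_single_pred {T k : ℕ} (hk : k ∈ Finset.Icc 2 T) (β : ℕ → ℝ) (L : ℝ) :
    ∑ t ∈ Finset.Icc 2 T, β t * (Pi.single (k - 1) L : ℕ → ℝ) (t - 1) = L * β k := by
  rw [Finset.sum_eq_single_of_mem k hk, Pi.single_eq_same, mul_comm]
  intro t ht htk
  rw [Finset.mem_Icc] at hk ht
  rw [Pi.single_eq_of_ne (by omega), mul_zero]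

theorem sum_mul_single_last (T : ℕ) (β : ℕ → ℝ) (L : ℝ) :
    ∑ t ∈ Finset.Icc 2 T, β t * (Pi.single T L : ℕ → ℝ) (t - 1) = 0 := by
  refine Finset.sum_eq_zero fun t ht => ?_
  rw [Finset.mem_Icc] at ht
  rw [Pi.single_eq_of_ne (by omega), mul_zero]

/-- (Strong duality for the epigraph constraint.) The infimum of the dual objective
over dual-feasible `(s₁, s₂)` is attained and equals `L^CLT · max(0, max_{2≤t≤T} β t)`;
in particular, it coincides with the maximum of `∑_{t=2}^T β t · l (t−1)` over
`l ∈ U^CLT`, which is also attained. -/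
theorem clt_epigraph_strong_duality (T : ℕ) (hT2 : 2 ≤ T) (m σ γ₂ : ℝ)
    (hm : 0 ≤ m) (hσ : 0 ≤ σ) (hγ : 0 ≤ γ₂) (β : ℕ → ℝ) :
    (∃ s₁ s₂ : ℝ,
      (0 ≤ s₁ ∧ 0 ≤ s₂ ∧ (∀ t ∈ Finset.Icc 2 T, s₁ - s₂ ≥ β t) ∧ s₁ - s₂ ≥ 0) ∧
      ((T : ℝ) * m + γ₂ * σ * Real.sqrt T) * s₁ +
          (γ₂ * σ * Real.sqrt T - (T : ℝ) * m) * s₂ =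
        LCLT T m σ γ₂ * max 0 ((Finset.Icc 2 T).sup' (Finset.nonempty_Icc.mpr hT2) β) ∧
      (∀ s₁' s₂' : ℝ,
        (0 ≤ s₁' ∧ 0 ≤ s₂' ∧ (∀ t ∈ Finset.Icc 2 T, s₁' - s₂' ≥ β t) ∧ s₁' - s₂' ≥ 0) →
        LCLT T m σ γ₂ * max 0 ((Finset.Icc 2 T).sup' (Finset.nonempty_Icc.mpr hT2) β) ≤
          ((T : ℝ) * m + γ₂ * σ * Real.sqrt T) * s₁' +
            (γ₂ * σ * Real.sqrt T - (T : ℝ) * m) * s₂')) ∧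
    (∃ l : ℕ → ℝ, UCLT T m σ γ₂ l ∧
      (∑ t ∈ Finset.Icc 2 T, β t * l (t - 1)) =
        LCLT T m σ γ₂ * max 0 ((Finset.Icc 2 T).sup' (Finset.nonempty_Icc.mpr hT2) β) ∧
      ∀ l' : ℕ → ℝ, UCLT T m σ γ₂ l' →
        (∑ t ∈ Finset.Icc 2 T, β t * l' (t - 1)) ≤
          LCLT T m σ γ₂ * max 0 ((Finset.Icc 2 T).sup' (Finset.nonempty_Icc.mpr hT2) β)) := by
  have hne : (Finset.Icc 2 T).Nonempty := Finset.nonempty_Icc.mpr hT2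
  have hle : ∀ t ∈ Finset.Icc 2 T, β t ≤ max 0 ((Finset.Icc 2 T).sup' hne β) :=
    fun t ht => le_max_of_le_right (Finset.le_sup' β ht)
  refine ⟨⟨max 0 ((Finset.Icc 2 T).sup' hne β), 0, ⟨le_max_left _ _, le_rfl, ?_, ?_⟩, ?_, ?_⟩, ?_⟩
  · simpa only [sub_zero] using hle
  · simp only [sub_zero, ge_iff_le, le_max_left]
  · rw [LCLT, mul_zero, add_zero]
  · rintro s₁ s₂ ⟨-, hs₂, hβ, h0⟩
    have hM : max 0 ((Finset.Icc 2 T).sup' hne β) ≤ s₁ - s₂ := max_le h0 (Finset.sup'_le hne β hβ)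
    have hdev : 0 ≤ γ₂ * σ * Real.sqrt T * s₂ := by positivity
    have hmul := mul_le_mul_of_nonneg_left hM (LCLT_nonneg T hm hσ hγ)
    refine hmul.trans ?_
    unfold LCLT
    linarith
  · suffices h : ∃ k ∈ Finset.Icc 1 T, ∑ t ∈ Finset.Icc 2 T,
        β t * (Pi.single k (LCLT T m σ γ₂) : ℕ → ℝ) (t - 1) =
          LCLT T m σ γ₂ * max 0 ((Finset.Icc 2 T).sup' hne β) by
      obtain ⟨k, hk, hsum⟩ := h
      exact ⟨_, UCLT_single hm hσ hγ hk, hsum,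
        fun l hl => hl.sum_mul_le (by omega) (le_max_left _ _) hle⟩
    rcases le_total ((Finset.Icc 2 T).sup' hne β) 0 with hneg | hpos
    · refine ⟨T, Finset.mem_Icc.mpr ⟨by omega, le_rfl⟩, ?_⟩
      rw [sum_mul_single_last, max_eq_left hneg, mul_zero]
    · obtain ⟨k, hk, hkβ⟩ := Finset.exists_mem_eq_sup' hne β
      refine ⟨k - 1, ?_, ?_⟩
      · rw [Finset.mem_Icc] at hk ⊢
        omega
      · rw [sum_mul_single_pred hk, max_eq_right hpos, hkβ]
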